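/- arXiv:2503.04575 — 3 statements merged into one kernel-verified Lean document; each statement's English description precedes it below -/
import Mathlib

section
/- For every T > 0, every real α > -1/2 with α not an integer, every i ∈ ℕ, and every natural number k ≥ 1, the coefficients F_i^α satisfy the recurrence in the degree: F_i^{α+k} = T^k · [(α+1)^{\overline{k}}]² / [ (α-i+1)^{\overline{k}} · (α+i+2)^{\overline{k}} ] · F_i^α, where x^{\overline{k}} = x(x+1)⋯(x+k-1) denotes the rising factorial. -/
open MeasureTheory Finset

/-- Coefficients of the shifted Legendre polynomials:
`l_{ik} = (-1)^(i-k) * C(i+k, i) * C(i, i-k)`. -/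
noncomputable def legCoef (i k : ℕ) : ℝ :=
  (-1 : ℝ) ^ (i - k) * (Nat.choose (i + k) i : ℝ) * (Nat.choose i (i - k) : ℝ)

/-- Shifted Legendre polynomials on `[0, T]`, orthonormal in `L²([0,T])`:
`P̂(i,t) = √((2i+1)/T) · Σ_{k=0}^i l_{ik} (t/T)^k`. -/
noncomputable def legP (T : ℝ) (i : ℕ) (t : ℝ) : ℝ :=
  Real.sqrt ((2 * i + 1) / T) * ∑ k ∈ Finset.range (i + 1), legCoef i k * (t / T) ^ k

/-- `F_i^α = ∫₀^T t^α P̂(i,t) dt`, the expansion coefficient of the power function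
`t ↦ t^α` relative to the `i`-th Legendre polynomial. -/
noncomputable def Fcoef (T α : ℝ) (i : ℕ) : ℝ :=
  ∫ t in (0:ℝ)..T, t ^ α * legP T i t

/-- Rising factorial `x^{\overline{k}} = x(x+1)⋯(x+k-1)`. -/
noncomputable def riseFac (x : ℝ) (k : ℕ) : ℝ :=
  ∏ m ∈ Finset.range k, (x + m)

theorem legCoef_succ_mul_sq {i k : ℕ} (hk : k < i) :
    legCoef i (k + 1) * ((k : ℝ) + 1) ^ 2 = -(legCoef i k * (i - k) * (i + k + 1)) := by
  have h₁ : ((i + k + 1 : ℕ) : ℝ) * ((i + k).choose i : ℝ)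
      = ((i + (k + 1)).choose i : ℝ) * ((k + 1 : ℕ) : ℝ) := by
    rw [Nat.choose_symm_add, Nat.choose_symm_add]
    exact_mod_cast Nat.add_one_mul_choose_eq (i + k) k
  have h₂ : (i.choose (i - (k + 1)) : ℝ) * ((k + 1 : ℕ) : ℝ)
      = (i.choose (i - k) : ℝ) * ((i : ℝ) - k) := by
    rw [Nat.choose_symm hk, Nat.choose_symm hk.le, ← Nat.cast_sub hk.le]
    exact_mod_cast Nat.choose_succ_right_eq i k
  have hpow : (-1 : ℝ) ^ (i - k) = -(-1 : ℝ) ^ (i - (k + 1)) := by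
    rw [show i - k = i - (k + 1) + 1 by omega, pow_succ]
    ring
  push_cast at h₁ h₂
  unfold legCoef
  rw [hpow]
  linear_combination (-(-1 : ℝ) ^ (i - (k + 1)) * (i.choose (i - k) : ℝ) * ((i : ℝ) - k)) * h₁
    + ((-1 : ℝ) ^ (i - (k + 1)) * ((i + (k + 1)).choose i : ℝ) * (k + 1)) * h₂

/-- Contiguity relation for `∑ l_{ik} / (x + k)`, the Mellin transform of a shifted Legendre
polynomial on `[0, 1]`. -/
theorem sum_legCoef_div_add_one {x : ℝ} (hx : 0 < x) (i : ℕ) :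
    (x - i) * (x + i + 1) * ∑ k ∈ range (i + 1), legCoef i k / (x + 1 + k)
      = x ^ 2 * ∑ k ∈ range (i + 1), legCoef i k / (x + k) := by
  have hne (k : ℕ) : x + k ≠ 0 := by positivity
  have hne' (k : ℕ) : x + 1 + k ≠ 0 := by positivity
  have hl (k : ℕ) : (x - i) * (x + i + 1) * (legCoef i k / (x + 1 + k))
      = legCoef i k * (x - k) - legCoef i k * (i - k) * (i + k + 1) / (x + 1 + k) := by
    have := hne' k
    field_simp
    ring
  have hr (k : ℕ) : x ^ 2 * (legCoef i k / (x + k))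
      = legCoef i k * (x - k) + legCoef i k * k ^ 2 / (x + k) := by
    have := hne k
    field_simp
    ring
  rw [mul_sum, mul_sum, sum_congr rfl fun k _ => hl k, sum_congr rfl fun k _ => hr k,
    sum_sub_distrib, sum_add_distrib, sub_eq_add_neg, ← sum_neg_distrib]
  congr 1
  rw [sum_range_succ, sum_range_succ']
  simp only [sub_self, mul_zero, zero_mul, zero_div, neg_zero, add_zero, Nat.cast_zero, ne_eq,
    OfNat.ofNat_ne_zero, not_false_eq_true, zero_pow]
  refine sum_congr rfl fun k hk => ?_
  rw [← neg_div, ← legCoef_succ_mul_sq (mem_range.1 hk)]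
  push_cast
  rw [add_assoc x 1, add_comm (1 : ℝ)]

theorem Fcoef_eq_sum {T α : ℝ} (hT : 0 < T) (hα : -1 < α) (i : ℕ) :
    Fcoef T α i = Real.sqrt ((2 * i + 1) / T) * T ^ (α + 1)
      * ∑ k ∈ range (i + 1), legCoef i k / (α + 1 + k) := by
  have hα' (k : ℕ) : -1 < α + k := by
    have : (0 : ℝ) ≤ k := k.cast_nonneg
    linarith
  have hint : ∀ t ∈ Set.uIoc 0 T, t ^ α * legP T i t
      = ∑ k ∈ range (i + 1),
        Real.sqrt ((2 * i + 1) / T) * legCoef i k / T ^ k * t ^ (α + k) := by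
    intro t ht
    rw [Set.uIoc_of_le hT.le] at ht
    rw [legP, mul_sum, mul_sum]
    refine sum_congr rfl fun k _ => ?_
    rw [Real.rpow_add ht.1, Real.rpow_natCast, div_pow]
    ring
  rw [Fcoef, intervalIntegral.integral_congr_ae (ae_of_all _ hint),
    intervalIntegral.integral_finsetSum fun k _ =>
      (intervalIntegral.intervalIntegrable_rpow' (hα' k)).const_mul _, mul_sum]
  refine sum_congr rfl fun k _ => ?_
  have hk : α + 1 + k ≠ 0 := by linarith [hα' k]
  rw [intervalIntegral.integral_const_mul, integral_rpow (.inl (hα' k)), add_right_comm,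
    Real.zero_rpow hk, sub_zero, Real.rpow_add hT, Real.rpow_natCast]
  field_simp

theorem Fcoef_add_one {T α : ℝ} (hT : 0 < T) (hα : -1 < α) (i : ℕ) :
    (α - i + 1) * (α + i + 2) * Fcoef T (α + 1) i = T * (α + 1) ^ 2 * Fcoef T α i := by
  rw [Fcoef_eq_sum hT hα, Fcoef_eq_sum hT (by linarith), Real.rpow_add hT (α + 1) 1,
    Real.rpow_one]
  linear_combination (Real.sqrt ((2 * i + 1) / T) * T ^ (α + 1) * T)
    * sum_legCoef_div_add_one (by linarith : 0 < α + 1) i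

theorem riseFac_succ (x : ℝ) (k : ℕ) : riseFac x (k + 1) = riseFac x k * (x + k) :=
  prod_range_succ _ _

theorem riseFac_ne_zero {x : ℝ} {k : ℕ} (hx : ∀ m < k, x + m ≠ 0) : riseFac x k ≠ 0 :=
  prod_ne_zero_iff.2 fun m hm => hx m (mem_range.1 hm)

theorem riseFac_mul_Fcoef_add {T α : ℝ} (hT : 0 < T) (hα : -1 < α) (i k : ℕ) :
    riseFac (α - i + 1) k * riseFac (α + i + 2) k * Fcoef T (α + k) i
      = T ^ k * riseFac (α + 1) k ^ 2 * Fcoef T α i := by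
  induction k with
  | zero => simp [riseFac]
  | succ k ih =>
    have hα' : -1 < α + k := by
      have : (0 : ℝ) ≤ k := k.cast_nonneg
      linarith
    simp only [riseFac_succ]
    push_cast
    rw [← add_assoc]
    linear_combination riseFac (α - i + 1) k * riseFac (α + i + 2) k * Fcoef_add_one hT hα' i
      + T * (α + k + 1) ^ 2 * ih

/-- recurrence in the degree `α`:
`F_i^{α+k} = T^k [(α+1)^{\overline{k}}]² / [(α-i+1)^{\overline{k}} (α+i+2)^{\overline{k}}] · F_i^α`. -/
theorem Fcoef_rec_degree (T : ℝ) (hT : 0 < T) (α : ℝ) (hα : -1/2 < α)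
    (hαnotint : ∀ n : ℤ, α ≠ n) (i : ℕ) (k : ℕ) (hk : 1 ≤ k) :
    Fcoef T (α + k) i =
      T ^ k * (riseFac (α + 1) k) ^ 2 /
        (riseFac (α - i + 1) k * riseFac (α + i + 2) k) * Fcoef T α i := by
  have h₁ : riseFac (α - i + 1) k ≠ 0 := riseFac_ne_zero fun m _ h =>
    hαnotint (i - 1 - m) (by push_cast; linarith)
  have h₂ : riseFac (α + i + 2) k ≠ 0 := riseFac_ne_zero fun m _ => by
    have : (0 : ℝ) < α + 1 := by linarith
    have : (0 : ℝ) < (α + 1) + i + 1 + m := by positivity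
    linarith
  rw [div_mul_eq_mul_div, eq_div_iff (mul_ne_zero h₁ h₂),
    ← riseFac_mul_Fcoef_add hT (by linarith) i k]
  ring
end

section
/- For every T > 0 and every real α > -1/2, Parseval's identity holds for the power function t ↦ t^α relative to the Legendre polynomials: the series Σ_{i=0}^∞ (F_i^α)² converges and its sum equals ∫₀^T t^{2α} dt = T^{2α+1}/(2α+1). -/
open MeasureTheory Finset

lemma prod_add_one_add_mul_factorial (k i : ℕ) :
    (∏ m ∈ range i, ((k : ℝ) + 1 + m)) * (k.factorial : ℝ) = ((i + k).factorial : ℝ) := by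
  induction i with
  | zero => simp
  | succ i ih =>
    rw [prod_range_succ, mul_right_comm, ih, show i + 1 + k = (i + k) + 1 by ring,
      Nat.factorial_succ]
    push_cast
    ring

lemma prod_range_sub_self (k : ℕ) :
    ∏ j ∈ range k, ((j : ℝ) - k) = (-1) ^ k * (k.factorial : ℝ) := by
  induction k with
  | zero => simp
  | succ k ih =>
    rw [prod_range_succ', Nat.factorial_succ, pow_succ]
    simp only [Nat.cast_add, Nat.cast_one, add_sub_add_right_eq_sub, ih]
    push_cast
    ring

lemma prod_erase_sub (k d : ℕ) :
    ∏ j ∈ (range (k + d + 1)).erase k, ((j : ℝ) - k) =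
      (-1) ^ k * (k.factorial : ℝ) * (d.factorial : ℝ) := by
  have h : ∏ j ∈ (range (k + d + 1)).erase k, ((j : ℝ) - k) =
      ∏ j ∈ range (k + 1 + d), if j = k then 1 else ((j : ℝ) - k) := by
    rw [add_right_comm k 1 d,
      ← prod_erase (range (k + d + 1)) (f := fun j => if j = k then 1 else ((j : ℝ) - k))
        (if_pos rfl)]
    exact prod_congr rfl fun j hj => by rw [if_neg (ne_of_mem_erase hj)]
  rw [h, prod_range_add, prod_range_succ, if_pos rfl, mul_one, ← prod_range_sub_self,
    Nat.factorial_eq_prod_range_add_one d]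
  push_cast
  congr 1
  · exact prod_congr rfl fun j hj => by rw [if_neg (mem_range.1 hj).ne]
  · exact prod_congr rfl fun j _ => by rw [if_neg (by omega)]; ring

/-- The shifted Legendre coefficients are the residues in the partial fraction decomposition of
`∏_{m<i} (x-1-m) / ∏_{m≤i} (x+m)`. -/
lemma sum_legCoef_div (i : ℕ) {x : ℝ} (hx : 0 < x) :
    ∑ k ∈ range (i + 1), legCoef i k / (x + k) =
      (∏ m ∈ range i, (x - (m + 1))) / ∏ m ∈ range (i + 1), (x + m) := by
  set v : ℕ → ℝ := fun k => -(k : ℝ) with hv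
  set p := Lagrange.nodal (range i) (fun m : ℕ => (m : ℝ) + 1) with hp
  have hinj : Set.InjOn v (range (i + 1) : Finset ℕ) := fun a _ b _ h => by simpa [hv] using h
  have hdeg : p.degree < ((range (i + 1)).card : ℕ) := by
    rw [hp, Lagrange.degree_nodal]
    simp only [card_range]
    exact_mod_cast Nat.lt_succ_self i
  have hpos : ∀ m : ℕ, 0 < x + m := fun m => by positivity
  have key := congrArg (Polynomial.eval x) (Lagrange.eq_interpolate hinj hdeg)
  rw [Lagrange.eval_interpolate_not_at_node _ fun k _ => by simp only [hv]; linarith [hpos k],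
    Lagrange.eval_nodal, Lagrange.eval_nodal] at key
  simp only [hv, sub_neg_eq_add] at key
  rw [key, mul_div_cancel_left₀ _ (prod_pos fun m _ => hpos m).ne']
  refine sum_congr rfl fun k hk => ?_
  obtain ⟨d, rfl⟩ := Nat.exists_eq_add_of_le (Nat.lt_succ_iff.1 (mem_range.1 hk))
  have hw : Lagrange.nodalWeight (range (k + d + 1)) (fun k : ℕ => -(k : ℝ)) k =
      ((-1) ^ k * (k.factorial : ℝ) * (d.factorial : ℝ))⁻¹ := by
    rw [Lagrange.nodalWeight, prod_inv_distrib, ← prod_erase_sub]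
    exact congrArg _ (prod_congr rfl fun j _ => by ring)
  have hev : p.eval (-(k : ℝ)) =
      (-1) ^ (k + d) * (((k + d + k).factorial : ℝ) / (k.factorial : ℝ)) := by
    rw [← prod_add_one_add_mul_factorial k (k + d), mul_div_cancel_right₀ _ (by positivity), hp,
      Lagrange.eval_nodal]
    calc _ = ∏ m ∈ range (k + d), (-1 : ℝ) * ((k : ℝ) + 1 + m) :=
          prod_congr rfl fun m _ => by ring
      _ = _ := by rw [prod_mul_distrib, prod_const, card_range]
  rw [hw, hev, legCoef, Nat.cast_add_choose, Nat.add_sub_cancel_left, add_comm k d,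
    Nat.cast_add_choose, pow_add]
  have hk' := (hpos k).ne'
  rcases neg_one_pow_eq_or ℝ k with h | h <;> rw [h] <;> field_simp

/-- Closed form of the Legendre coefficients of `t ↦ t^α` on `[0, 1]`, up to normalization. -/
noncomputable def powerLegendreCoef (α : ℝ) (i : ℕ) : ℝ :=
  (∏ m ∈ range i, (α - m)) / ∏ m ∈ range (i + 1), (α + 1 + m)

lemma Fcoef_eq {T : ℝ} (hT : 0 < T) {α : ℝ} (hα : -1 / 2 < α) (i : ℕ) :
    Fcoef T α i = Real.sqrt ((2 * i + 1) / T) * T ^ (α + 1) * powerLegendreCoef α i := by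
  have hint : ∀ k : ℕ, ∫ t in (0 : ℝ)..T, t ^ (α + k) = T ^ (α + 1) * T ^ k / (α + 1 + k) := by
    intro k
    have hk : (0 : ℝ) ≤ k := k.cast_nonneg
    rw [integral_rpow (Or.inl (by linarith)), Real.zero_rpow (by linarith), sub_zero,
      add_right_comm, Real.rpow_add_natCast hT.ne']
  have hcongr : ∀ t ∈ Set.uIoc 0 T, t ^ α * legP T i t =
      ∑ k ∈ range (i + 1), Real.sqrt ((2 * i + 1) / T) * legCoef i k / T ^ k * t ^ (α + k) := by
    intro t ht
    rw [Set.uIoc_of_le hT.le] at ht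
    rw [legP, mul_sum, mul_sum]
    refine sum_congr rfl fun k _ => ?_
    rw [Real.rpow_add_natCast ht.1.ne', div_pow]
    ring
  rw [Fcoef, intervalIntegral.integral_congr_ae (ae_of_all _ hcongr), intervalIntegral.integral_finsetSum]
  · simp only [intervalIntegral.integral_const_mul, hint]
    have hsum := sum_legCoef_div i (x := α + 1) (by linarith)
    rw [powerLegendreCoef]
    have hnum : ∏ m ∈ range i, (α + 1 - ((m : ℝ) + 1)) = ∏ m ∈ range i, (α - m) :=
      prod_congr rfl fun m _ => by ring
    rw [← hnum, ← hsum, mul_sum]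
    refine sum_congr rfl fun k _ => ?_
    field_simp
  · intro k _
    have hk : (0 : ℝ) ≤ k := k.cast_nonneg
    exact (intervalIntegral.intervalIntegrable_rpow' (by linarith)).const_mul _

/-- The squared `L²` distance, up to normalization, from `t ↦ t^α` to the polynomials of
degree less than `n`. -/
noncomputable def powerResidual (α : ℝ) (n : ℕ) : ℝ :=
  ∏ m ∈ range n, ((α - m) / (α + 1 + m)) ^ 2

lemma sum_powerLegendreCoef_sq {α : ℝ} (hα : -1 / 2 < α) (n : ℕ) :
    ∑ i ∈ range n, (2 * (i : ℝ) + 1) * powerLegendreCoef α i ^ 2 =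
      (1 - powerResidual α n) / (2 * α + 1) := by
  have h2 : 2 * α + 1 ≠ 0 := by linarith
  induction n with
  | zero => simp [powerResidual]
  | succ n ih =>
    have hn : α + 1 + n ≠ 0 := by
      have : (0 : ℝ) ≤ n := n.cast_nonneg
      linarith
    have hcoef : powerLegendreCoef α n ^ 2 = powerResidual α n / (α + 1 + n) ^ 2 := by
      rw [powerLegendreCoef, powerResidual, prod_pow, prod_div_distrib, prod_range_succ _ n,
        ← div_div, div_pow]
    rw [sum_range_succ, ih, hcoef, show powerResidual α (n + 1) =
      powerResidual α n * ((α - n) / (α + 1 + n)) ^ 2 from prod_range_succ _ _]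
    field_simp
    ring

lemma tendsto_powerResidual {α : ℝ} (hα : -1 / 2 < α) :
    Filter.Tendsto (powerResidual α) Filter.atTop (nhds 0) := by
  have hc : 0 < (2 * α + 1) / (|α| + 1) ^ 2 := div_pos (by linarith) (by positivity)
  have hfactor : ∀ m : ℕ, ((α - m) / (α + 1 + m)) ^ 2 ≤
      Real.exp (-((2 * α + 1) / (|α| + 1) ^ 2 * (1 / ((m : ℝ) + 1)))) := by
    intro m
    have hm : (0 : ℝ) ≤ m := m.cast_nonneg
    have hpos : 0 < α + 1 + m := by linarith
    refine le_trans ?_ (Real.one_sub_le_exp_neg _)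
    have heq : ((α - m) / (α + 1 + m)) ^ 2 =
        1 - (2 * α + 1) * ((2 * m + 1) / (α + 1 + m) ^ 2) := by
      field_simp
      ring
    have hle : α + 1 + m ≤ (|α| + 1) * (m + 1) := by
      nlinarith [le_abs_self α, mul_nonneg (abs_nonneg α) hm]
    have hcmp : 1 / ((|α| + 1) ^ 2 * ((m : ℝ) + 1)) ≤ (2 * m + 1) / (α + 1 + m) ^ 2 := by
      rw [div_le_div_iff₀ (by positivity) (by positivity)]
      calc 1 * (α + 1 + m) ^ 2 ≤ ((|α| + 1) * (m + 1)) ^ 2 := by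
            rw [one_mul]
            gcongr
        _ = (m + 1) * ((|α| + 1) ^ 2 * (m + 1)) := by ring
        _ ≤ (2 * m + 1) * ((|α| + 1) ^ 2 * (m + 1)) := by
            gcongr
            linarith
    have := mul_le_mul_of_nonneg_left hcmp (show 0 ≤ 2 * α + 1 by linarith)
    rw [heq, div_mul_div_comm, mul_one]
    rw [mul_one_div] at this
    linarith
  refine squeeze_zero (fun n => prod_nonneg fun m _ => sq_nonneg _)
    (fun n => prod_le_prod (fun m _ => sq_nonneg _) fun m _ => hfactor m) ?_
  simp only [← Real.exp_sum, sum_neg_distrib, ← mul_sum]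
  exact Real.tendsto_exp_neg_atTop_nhds_zero.comp
    (Real.tendsto_sum_range_one_div_nat_succ_atTop.const_mul_atTop hc)

/-- Parseval's identity for the power function `t ↦ t^α`:
`Σ_{i=0}^∞ (F_i^α)² = ∫₀^T t^{2α} dt = T^{2α+1}/(2α+1)`. -/
theorem Fcoef_parseval (T : ℝ) (hT : 0 < T) (α : ℝ) (hα : -1/2 < α) :
    HasSum (fun i : ℕ => (Fcoef T α i) ^ 2) (∫ t in (0:ℝ)..T, t ^ (2 * α)) ∧
      (∫ t in (0:ℝ)..T, t ^ (2 * α)) = T ^ (2 * α + 1) / (2 * α + 1) := by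
  have h2 : 0 < 2 * α + 1 := by linarith
  have hint : (∫ t in (0:ℝ)..T, t ^ (2 * α)) = T ^ (2 * α + 1) / (2 * α + 1) := by
    rw [integral_rpow (Or.inl (by linarith)), Real.zero_rpow h2.ne', sub_zero]
  refine ⟨?_, hint⟩
  have hsq : ∀ i : ℕ, Fcoef T α i ^ 2 =
      T ^ (2 * α + 1) * ((2 * (i : ℝ) + 1) * powerLegendreCoef α i ^ 2) := by
    intro i
    have hpow : (T ^ (α + 1)) ^ 2 = T ^ (2 * α + 1) * T := by
      rw [← Real.rpow_natCast, ← Real.rpow_mul hT.le, ← Real.rpow_add_one hT.ne']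
      congr 1
      push_cast
      ring
    rw [Fcoef_eq hT hα, mul_pow, mul_pow, Real.sq_sqrt (by positivity), hpow]
    field_simp
  rw [hint, hasSum_iff_tendsto_nat_of_nonneg fun i => sq_nonneg _]
  simp only [hsq, ← mul_sum, sum_powerLegendreCoef_sq hα]
  have hlim := (((tendsto_powerResidual hα).const_sub 1).div_const (2 * α + 1)).const_mul
    (T ^ (2 * α + 1))
  simpa [div_eq_mul_inv] using hlim
end

section
/- For every T > 0, every real β > 0, and all i, j ∈ ℕ, the matrix element of the Riemann–Liouville fractional integration operator of order β relative to the Legendre polynomials satisfies the column formula P_{ij}^{-β} = (1/Γ(β+1)) · √((2j+1)/T) · Σ_{k=0}^j [ l_{jk} · k! / ( T^k · (β+1)^{\overline{k}} ) ] · F_i^{β+k}, where (β+1)^{\overline{k}} = (β+1)(β+2)⋯(β+k) is the rising factorial. -/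
open MeasureTheory Finset

/-- Left-sided Riemann–Liouville fractional integral of order `β`:
`(J^β φ)(t) = (1/Γ(β)) ∫₀^t φ(τ)(t-τ)^{β-1} dτ`. -/
noncomputable def rlInt (β : ℝ) (φ : ℝ → ℝ) (t : ℝ) : ℝ :=
  (1 / Real.Gamma β) * ∫ τ in (0:ℝ)..t, φ τ * (t - τ) ^ (β - 1)

/-- `P_{ij}^{-β} = ∫₀^T P̂(i,t) (J^β P̂(j,·))(t) dt`. -/
noncomputable def Pcoef (T β : ℝ) (i j : ℕ) : ℝ :=
  ∫ t in (0:ℝ)..T, legP T i t * rlInt β (legP T j) t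

open intervalIntegral in
/-- The kernel `(t - τ)^(β-1)` times a continuous function is integrable on `[0, t]`. -/
lemma Continuous.intervalIntegrable_mul_sub_rpow {β : ℝ} (hβ : 0 < β) (t : ℝ) {f : ℝ → ℝ}
    (hf : Continuous f) :
    IntervalIntegrable (fun τ => f τ * (t - τ) ^ (β - 1)) volume 0 t := by
  have h : IntervalIntegrable (fun x : ℝ => x ^ (β - 1)) volume t 0 :=
    intervalIntegrable_rpow' (by linarith)
  have h' := h.comp_sub_left t
  simp only [sub_self, sub_zero] at h'
  exact h'.continuousOn_mul hf.continuousOn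

lemma integral_pow_mul_sub_rpow {β : ℝ} (hβ : 0 < β) (k : ℕ) {t : ℝ} (ht : 0 ≤ t) :
    ∫ τ in (0:ℝ)..t, τ ^ k * (t - τ) ^ (β - 1) =
      t ^ (β + k) * ((Nat.factorial k : ℝ) / (β * riseFac (β + 1) k)) := by
  rcases ht.eq_or_lt with rfl | ht
  · rw [intervalIntegral.integral_same, Real.zero_rpow (by positivity), zero_mul]
  have hscaled := Complex.betaIntegral_scaled ((k : ℂ) + 1) (β : ℂ) ht
  rw [← Complex.betaIntegral_symm, Complex.betaIntegral_eval_nat_add_one_right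
    (by simpa using hβ)] at hscaled
  have hprod : ∏ m ∈ Finset.range (k + 1), (β + m) = β * riseFac (β + 1) k := by
    rw [Finset.prod_range_succ', riseFac, mul_comm]
    simp only [Nat.cast_zero, add_zero, Nat.cast_add, Nat.cast_one]
    congr 1
    exact Finset.prod_congr rfl fun m _ => by ring
  rw [← hprod]
  apply Complex.ofReal_injective
  rw [← intervalIntegral.integral_ofReal]
  push_cast [Complex.ofReal_cpow ht.le]
  rw [show (β : ℂ) + k = (k + 1) + β - 1 by ring, ← hscaled]
  refine intervalIntegral.integral_congr fun τ hτ => ?_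
  rw [Set.uIcc_of_le ht.le] at hτ
  simp only [add_sub_cancel_right, Complex.cpow_natCast]
  rw [Complex.ofReal_cpow (sub_nonneg.2 hτ.2)]
  push_cast
  rfl

lemma continuous_legP (T : ℝ) (i : ℕ) : Continuous (legP T i) := by
  unfold legP
  fun_prop

lemma rlInt_legP (T : ℝ) {β : ℝ} (hβ : 0 < β) (j : ℕ) {t : ℝ} (ht : 0 ≤ t) :
    rlInt β (legP T j) t =
      (1 / Real.Gamma (β + 1)) * Real.sqrt ((2 * j + 1) / T) *
        ∑ k ∈ Finset.range (j + 1),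
          legCoef j k * (Nat.factorial k : ℝ) / (T ^ k * riseFac (β + 1) k) * t ^ (β + k) := by
  have hexpand : ∀ τ : ℝ, legP T j τ * (t - τ) ^ (β - 1) =
      ∑ k ∈ Finset.range (j + 1), Real.sqrt ((2 * j + 1) / T) * (legCoef j k / T ^ k) *
        (τ ^ k * (t - τ) ^ (β - 1)) := by
    intro τ
    rw [legP, Finset.mul_sum, Finset.sum_mul]
    exact Finset.sum_congr rfl fun k _ => by rw [div_pow]; ring
  simp_rw [rlInt, hexpand]
  rw [intervalIntegral.integral_finsetSum fun k _ =>
    ((continuous_pow k).intervalIntegrable_mul_sub_rpow hβ t).const_mul _]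
  simp_rw [intervalIntegral.integral_const_mul, integral_pow_mul_sub_rpow hβ _ ht]
  rw [Real.Gamma_add_one hβ.ne', Finset.mul_sum, Finset.mul_sum]
  refine Finset.sum_congr rfl fun k _ => ?_
  simp only [div_eq_mul_inv, mul_inv]
  ring

/-- column formula for the matrix representation of the fractional
integration operator:
`P_{ij}^{-β} = (1/Γ(β+1)) √((2j+1)/T) Σ_{k=0}^j l_{jk} k! / (T^k (β+1)^{\overline{k}}) F_i^{β+k}`. -/
theorem Pcoef_column_formula (T : ℝ) (hT : 0 < T) (β : ℝ) (hβ : 0 < β) (i j : ℕ) :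
    Pcoef T β i j =
      (1 / Real.Gamma (β + 1)) * Real.sqrt ((2 * j + 1) / T) *
        ∑ k ∈ Finset.range (j + 1),
          legCoef j k * (Nat.factorial k : ℝ) / (T ^ k * riseFac (β + 1) k) *
            Fcoef T (β + k) i := by
  have hcongr : Set.EqOn (fun t => legP T i t * rlInt β (legP T j) t)
      (fun t => ∑ k ∈ Finset.range (j + 1),
        (1 / Real.Gamma (β + 1)) * Real.sqrt ((2 * j + 1) / T) *
          (legCoef j k * (Nat.factorial k : ℝ) / (T ^ k * riseFac (β + 1) k)) *
            (t ^ (β + k) * legP T i t)) (Set.uIcc 0 T) := by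
    intro t ht
    rw [Set.uIcc_of_le hT.le] at ht
    simp only [rlInt_legP T hβ j ht.1, Finset.mul_sum]
    exact Finset.sum_congr rfl fun k _ => by ring
  rw [Pcoef, intervalIntegral.integral_congr hcongr, intervalIntegral.integral_finsetSum]
  · simp_rw [intervalIntegral.integral_const_mul, Finset.mul_sum, Fcoef, mul_assoc]
  · intro k _
    have hpow : Continuous fun t : ℝ => t ^ (β + k) :=
      Real.continuous_rpow_const (by positivity)
    exact ((hpow.mul (continuous_legP T i)).intervalIntegrable 0 T).const_mul _
end
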